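/- arXiv:0811.3833 — 5 statements merged into one kernel-verified Lean document; each statement's English description precedes it below -/
import Mathlib

section
/- Let K be a field of characteristic p with p > 0 and p ≠ 3, and let I_A ⊂ K[x₁,…,x₁₀] be the toric ideal of the (3,3)-Veronese configuration A = {(a₁,a₂,a₃) ∈ ℕ³ : a₁+a₂+a₃ = 3}. Then I_A is generated up to radical by 8 binomials, i.e. bar(I_A) ≤ 8. -/
open MvPolynomial

namespace LatticePaper

variable {m n : ℕ}

/-- The positive part `u₊` of an integer vector, as an exponent vector. -/
noncomputable def pp (u : Fin m → ℤ) : Fin m →₀ ℕ :=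
  Finsupp.equivFunOnFinite.symm fun i => (u i).toNat

/-- The negative part `u₋` of an integer vector, as an exponent vector. -/
noncomputable def np (u : Fin m → ℤ) : Fin m →₀ ℕ :=
  Finsupp.equivFunOnFinite.symm fun i => (-u i).toNat

/-- The positive part `u₊` as an integer vector. -/
def ppz (u : Fin m → ℤ) : Fin m → ℤ := fun i => max (u i) 0

/-- The negative part `u₋` as an integer vector. -/
def npz (u : Fin m → ℤ) : Fin m → ℤ := fun i => max (-u i) 0

/-- `ℤ^E`, the subgroup of vectors supported on `E`. -/
def ZE (E : Set (Fin m)) : AddSubgroup (Fin m → ℤ) where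
  carrier := {u | ∀ i, i ∉ E → u i = 0}
  add_mem' := by intro a b ha hb i hi; simp [ha i hi, hb i hi]
  zero_mem' := by intro i _; rfl
  neg_mem' := by intro a ha i hi; simp [ha i hi]

/-- `L` is a positive lattice: `L ∩ ℕ^m = {0}`. -/
def IsPositive (L : AddSubgroup (Fin m → ℤ)) : Prop :=
  ∀ u ∈ L, (∀ i, 0 ≤ u i) → u = 0

/-- The binomial `B(u) = x^{u₊} - ρ(u) x^{u₋}` attached to a partial character `ρ` on `L`. -/
noncomputable def Bpoly (K : Type*) [Field K] {L : AddSubgroup (Fin m → ℤ)}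
    (ρ : AddChar L Kˣ) (u : L) : MvPolynomial (Fin m) K :=
  monomial (pp (u : Fin m → ℤ)) (1 : K) - monomial (np (u : Fin m → ℤ)) ((ρ u : Kˣ) : K)

/-- The ideal generated by the binomials `B(u)` for `u ∈ L` with `u ∈ S`. -/
noncomputable def latIdealOn (K : Type*) [Field K] {L : AddSubgroup (Fin m → ℤ)}
    (ρ : AddChar L Kˣ) (S : Set (Fin m → ℤ)) : Ideal (MvPolynomial (Fin m) K) :=
  Ideal.span {f | ∃ u : L, (u : Fin m → ℤ) ∈ S ∧ f = Bpoly K ρ u}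

/-- The lattice ideal `I_{L,ρ}`. -/
noncomputable def latIdeal (K : Type*) [Field K] {L : AddSubgroup (Fin m → ℤ)}
    (ρ : AddChar L Kˣ) : Ideal (MvPolynomial (Fin m) K) :=
  latIdealOn K ρ Set.univ

/-- The configuration vectors, regarded over `ℚ`. -/
def ratA (A : Fin m → Fin n → ℤ) : Fin m → Fin n → ℚ := fun i j => (A i j : ℚ)

/-- The rational polyhedral cone `pos_ℚ(A)`. -/
def cone (A : Fin m → Fin n → ℤ) : Set (Fin n → ℚ) :=
  {x | ∃ lam : Fin m → ℚ, (∀ i, 0 ≤ lam i) ∧ x = ∑ i, lam i • ratA A i}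

/-- `F` is a face of the cone `pos_ℚ(A)`. -/
def IsFace (A : Fin m → Fin n → ℤ) (F : Set (Fin n → ℚ)) : Prop :=
  ∃ c : Fin n → ℚ, (∀ x ∈ cone A, 0 ≤ ∑ j, c j * x j) ∧
    F = cone A ∩ {x | ∑ j, c j * x j = 0}

/-- `𝔼_F = {i | a_i ∈ F}`. -/
def EF (A : Fin m → Fin n → ℤ) (F : Set (Fin n → ℚ)) : Set (Fin m) :=
  {i | ratA A i ∈ F}

/-- `A` is the configuration of vectors associated to the lattice `L`:
the `A`-degree map `ℤ^m → ℤ^n` is surjective with kernel `Sat(L)`. -/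
def IsConfig (L : AddSubgroup (Fin m → ℤ)) (A : Fin m → Fin n → ℤ) : Prop :=
  (∀ u : Fin m → ℤ, (∑ i, u i • A i) = 0 ↔ ∃ d : ℤ, d ≠ 0 ∧ d • u ∈ L) ∧
  Function.Surjective fun u : Fin m → ℤ => ∑ i, u i • A i

/-- A polynomial is `A`-homogeneous if all its monomials have the same `A`-degree. -/
def AHomog {K : Type*} [Field K] (A : Fin m → Fin n → ℤ) (f : MvPolynomial (Fin m) K) : Prop :=
  ∀ d ∈ f.support, ∀ e ∈ f.support, (∑ i, (d i : ℤ) • A i) = ∑ i, (e i : ℤ) • A i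

/-- The family of binomials `B(u i)` is a cover of `A`. -/
def IsCover {q : ℕ} (A : Fin m → Fin n → ℤ) (u : Fin q → Fin m → ℤ) : Prop :=
  ∀ E : Set (Fin m), (∀ F : Set (Fin n → ℚ), IsFace A F → E ≠ EF A F) →
    ∃ i, (ppz (u i) ∈ ZE E ∧ npz (u i) ∉ ZE E) ∨ (npz (u i) ∈ ZE E ∧ ppz (u i) ∉ ZE E)

/-- The minimal number of generators of an ideal. -/
noncomputable def mu {R : Type*} [CommRing R] (I : Ideal R) : ℕ :=
  sInf {s : ℕ | ∃ f : Fin s → R, Ideal.span (Set.range f) = I}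

/-- The arithmetical rank of an ideal. -/
noncomputable def ara {R : Type*} [CommRing R] (I : Ideal R) : ℕ :=
  sInf {s : ℕ | ∃ f : Fin s → R, (∀ i, f i ∈ I) ∧
    Ideal.radical (Ideal.span (Set.range f)) = Ideal.radical I}

/-- A binomial: a sum of (at most) two monomials. -/
def IsBinomial {K : Type*} [Field K] (f : MvPolynomial (Fin m) K) : Prop :=
  ∃ (a b : Fin m →₀ ℕ) (c d : K), f = monomial a c + monomial b d

/-- The binomial arithmetical rank of an ideal of a polynomial ring. -/
noncomputable def bar {K : Type*} [Field K] (I : Ideal (MvPolynomial (Fin m) K)) : ℕ :=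
  sInf {s : ℕ | ∃ f : Fin s → MvPolynomial (Fin m) K,
    (∀ i, f i ∈ I ∧ IsBinomial (f i)) ∧
    Ideal.radical (Ideal.span (Set.range f)) = Ideal.radical I}

/-- The rank of a sublattice of `ℤ^m`. -/
noncomputable def latRank (L : AddSubgroup (Fin m → ℤ)) : ℕ :=
  Module.finrank ℤ ↥(AddSubgroup.toIntSubmodule L)

/-- The toric ideal of a configuration `A` (trivial character). -/
noncomputable def toricIdeal (K : Type*) [Field K] (A : Fin m → Fin n → ℤ) :
    Ideal (MvPolynomial (Fin m) K) :=
  Ideal.span {f | ∃ u : Fin m → ℤ, (∑ i, u i • A i) = 0 ∧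
    f = monomial (pp u) (1 : K) - monomial (np u) 1}

/-- The lattice ideal of `L` with trivial character. -/
noncomputable def latIdeal1 (K : Type*) [Field K] (L : AddSubgroup (Fin m → ℤ)) :
    Ideal (MvPolynomial (Fin m) K) :=
  Ideal.span {f | ∃ u ∈ L, f = monomial (pp u) (1 : K) - monomial (np u) 1}

/-- A full configuration of vectors: `pos_ℚ(A)` is an `n`-dimensional simplex cone generated
by the first `n` vectors, and the remaining vectors lie in its relative interior. -/
def IsFull (hnm : n ≤ m) (A : Fin m → Fin n → ℤ) : Prop :=
  LinearIndependent ℚ (fun i : Fin n => ratA A (Fin.castLE hnm i)) ∧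
  cone A = cone (fun i : Fin n => A (Fin.castLE hnm i)) ∧
  ∀ i : Fin m, n ≤ (i : ℕ) → ∃ lam : Fin n → ℚ, (∀ k, 0 < lam k) ∧
    ratA A i = ∑ k, lam k • ratA A (Fin.castLE hnm k)

end LatticePaper

namespace LatticePaper

/-- The (3,3)-Veronese configuration. -/
def veroneseA : Fin 10 → Fin 3 → ℤ :=
  ![![3,0,0], ![0,3,0], ![0,0,3], ![2,1,0], ![1,2,0],
    ![0,2,1], ![0,1,2], ![2,0,1], ![1,0,2], ![1,1,1]]

def e1v (m q : ℕ) : Fin 4 → ℤ :=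
  ![(m : ℤ) + 2 * (q : ℤ) - 3, -(m : ℤ) + 2 * (q : ℤ) + 5, -1, -1]

def e2v (m q : ℕ) : Fin 4 → ℤ :=
  ![-(m : ℤ) - 2 * (q : ℤ) + 5, (m : ℤ) - 2 * (q : ℤ) - 3, -1, -1]

def e3v (m q : ℕ) : Fin 4 → ℤ :=
  ![-(m : ℤ) - 2 * (q : ℤ) + 5, -1, (m : ℤ) - 3, -1]

/-- The lattice `L(m)` of the examples. -/
def Lm (m q : ℕ) : AddSubgroup (Fin 4 → ℤ) :=
  AddSubgroup.closure {e1v m q, e2v m q, e3v m q}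

noncomputable def fpoly1 (K : Type*) [Field K] (m q : ℕ) : MvPolynomial (Fin 4) K :=
  X 0 ^ (m + 2 * q - 3) - X 1 ^ (m - 2 * q - 5) * X 2 * X 3

noncomputable def fpoly2 (K : Type*) [Field K] (m q : ℕ) : MvPolynomial (Fin 4) K :=
  X 1 ^ (m - 2 * q - 3) - X 0 ^ (m + 2 * q - 5) * X 2 * X 3

noncomputable def fpoly3 (K : Type*) [Field K] (m q : ℕ) : MvPolynomial (Fin 4) K :=
  X 2 ^ (m - 3) - X 0 ^ (m + 2 * q - 5) * X 1 * X 3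

noncomputable def fpoly123 (K : Type*) [Field K] (m : ℕ) : MvPolynomial (Fin 4) K :=
  if Even m then X 3 ^ (m - 3) - X 0 * X 1 ^ (m - 5) * X 2
  else X 3 ^ (m - 3) - X 0 ^ (m - 3) * X 1 * X 2

end LatticePaper

namespace LatticePaper

lemma aux14_cube {F : Type*} [Field F] [IsAlgClosed F] (a : F) : ∃ t : F, t ^ 3 = a :=
  IsAlgClosed.exists_pow_nat_eq a (by norm_num)

/-- Parametrization of one edge when the first vertex is nonzero. -/
lemma aux14_edge {F : Type*} [Field F] {r q : ℕ} (hq : q = 3 * r + 4)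
    (hinj : ∀ x y : F, x ^ q = y ^ q → x = y) {A B x y t : F} (ht : t ^ 3 = A) (hA : A ≠ 0)
    (h1 : x ^ 3 = A ^ 2 * B) (h2 : y ^ q = A ^ r * B ^ (2 * r + 2) * x ^ 2) :
    ∃ s : F, s ^ 3 = B ∧ x = t ^ 2 * s ∧ y = t * s ^ 2 := by
  have ht0 : t ≠ 0 := by
    rintro rfl
    exact hA (by rw [← ht]; norm_num)
  refine ⟨x / t ^ 2, ?_, ?_, ?_⟩
  · rw [div_pow, h1, ← ht]
    field_simp
  · field_simp
  · have hB : (x / t ^ 2) ^ 3 = B := by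
      rw [div_pow, h1, ← ht]
      field_simp
    have hx : x = t ^ 2 * (x / t ^ 2) := by field_simp
    generalize x / t ^ 2 = s at *
    apply hinj
    rw [h2, hx, ← ht, ← hB, hq]
    ring

lemma aux14_param {F : Type*} [Field F] [IsAlgClosed F] {r q : ℕ} (hq : q = 3 * r + 4)
    (hinj : ∀ x y : F, x ^ q = y ^ q → x = y) {A B C x4 x5 x6 x7 x8 x9 x10 : F}
    (h0 : x4 ^ 3 = A ^ 2 * B) (h1 : x6 ^ 3 = B ^ 2 * C) (h2 : x9 ^ 3 = C ^ 2 * A)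
    (h3 : x4 * x6 * x9 = A * B * C)
    (h4 : x5 ^ q = A ^ r * B ^ (2 * r + 2) * x4 ^ 2)
    (h5 : x7 ^ q = B ^ r * C ^ (2 * r + 2) * x6 ^ 2)
    (h6 : x8 ^ q = C ^ r * A ^ (2 * r + 2) * x9 ^ 2)
    (h7 : x10 ^ q = A ^ r * B ^ r * C ^ (r + 1) * x4 ^ 2 * x6) :
    ∃ a b c : F, A = a ^ 3 ∧ B = b ^ 3 ∧ C = c ^ 3 ∧ x4 = a ^ 2 * b ∧ x5 = a * b ^ 2 ∧
      x6 = b ^ 2 * c ∧ x7 = b * c ^ 2 ∧ x8 = a ^ 2 * c ∧ x9 = a * c ^ 2 ∧ x10 = a * b * c := by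
  have hq0 : q ≠ 0 := by omega
  have h30 : (3 : ℕ) ≠ 0 := by norm_num
  have z : ∀ {x : F} {n : ℕ}, n ≠ 0 → x ^ n = 0 → x = 0 := fun _ h => pow_eq_zero_iff (by assumption) |>.1 h
  by_cases hA : A = 0
  · subst hA
    have e4 : x4 = 0 := z h30 (by rw [h0]; ring)
    have e9 : x9 = 0 := z h30 (by rw [h2]; ring)
    have e5 : x5 = 0 := z hq0 (by rw [h4, e4]; ring)
    have e8 : x8 = 0 := z hq0 (by rw [h6, e9]; ring)
    have e10 : x10 = 0 := z hq0 (by rw [h7, e4]; ring)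
    by_cases hB : B = 0
    · subst hB
      have e6 : x6 = 0 := z h30 (by rw [h1]; ring)
      have e7 : x7 = 0 := z hq0 (by rw [h5, e6]; ring)
      obtain ⟨c, hc⟩ := aux14_cube C
      exact ⟨0, 0, c, by simp [e4, e5, e6, e7, e8, e9, e10, hc]⟩
    · obtain ⟨b, hb⟩ := aux14_cube B
      obtain ⟨c, hc, h6', h7'⟩ := aux14_edge hq hinj hb hB h1 h5
      refine ⟨0, b, c, ?_, hb.symm, hc.symm, ?_, ?_, h6', h7', ?_, ?_, ?_⟩ <;> simp [e4, e5, e8, e9, e10]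
  by_cases hC : C = 0
  · subst hC
    have e6 : x6 = 0 := z h30 (by rw [h1]; ring)
    have e9 : x9 = 0 := z h30 (by rw [h2]; ring)
    have e7 : x7 = 0 := z hq0 (by rw [h5, e6]; ring)
    have e8 : x8 = 0 := z hq0 (by rw [h6, e9]; ring)
    have e10 : x10 = 0 := z hq0 (by rw [h7, e6]; ring)
    obtain ⟨a, ha⟩ := aux14_cube A
    obtain ⟨b, hb, h4', h5'⟩ := aux14_edge hq hinj ha hA h0 h4
    refine ⟨a, b, 0, ha.symm, hb.symm, ?_, h4', h5', ?_, ?_, ?_, ?_, ?_⟩ <;> simp [e6, e7, e8, e9, e10]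
  by_cases hB : B = 0
  · subst hB
    have e4 : x4 = 0 := z h30 (by rw [h0]; ring)
    have e6 : x6 = 0 := z h30 (by rw [h1]; ring)
    have e5 : x5 = 0 := z hq0 (by rw [h4, e4]; ring)
    have e7 : x7 = 0 := z hq0 (by rw [h5, e6]; ring)
    have e10 : x10 = 0 := z hq0 (by rw [h7, e4]; ring)
    obtain ⟨c, hc⟩ := aux14_cube C
    obtain ⟨a, ha, h9', h8'⟩ := aux14_edge hq hinj hc hC h2 h6
    refine ⟨a, 0, c, ha.symm, ?_, hc.symm, ?_, ?_, ?_, ?_, ?_, ?_, ?_⟩ <;>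
      first | simp [e4, e5, e6, e7, e10] | (rw [h8']; ring) | (rw [h9']; ring)
  obtain ⟨a, ha⟩ := aux14_cube A
  obtain ⟨b, hb, h4', h5'⟩ := aux14_edge hq hinj ha hA h0 h4
  obtain ⟨c, hc, h6', h7'⟩ := aux14_edge hq hinj hb hB h1 h5
  have ha0 : a ≠ 0 := by rintro rfl; exact hA (by rw [← ha]; norm_num)
  have hb0 : b ≠ 0 := by rintro rfl; exact hB (by rw [← hb]; norm_num)
  have hc0 : c ≠ 0 := by rintro rfl; exact hC (by rw [← hc]; norm_num)
  have h9' : x9 = a * c ^ 2 := by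
    have hne : x4 * x6 ≠ 0 := by rw [h4', h6']; positivity
    apply mul_left_cancel₀ hne
    rw [h3, h4', h6', ← ha, ← hb, ← hc]
    ring
  refine ⟨a, b, c, ha.symm, hb.symm, hc.symm, h4', h5', h6', h7', ?_, h9', ?_⟩
  · apply hinj
    rw [h6, h9', ← ha, ← hc, hq]
    ring
  · apply hinj
    rw [h7, h4', h6', ← ha, ← hb, ← hc, hq]
    ring

/-- The exponent differences of the eight binomials. -/
def aux14u (r : ℕ) : Fin 8 → Fin 10 → ℤ :=
  ![![-2, -1, 0, 3, 0, 0, 0, 0, 0, 0],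
    ![0, -2, -1, 0, 0, 3, 0, 0, 0, 0],
    ![-1, 0, -2, 0, 0, 0, 0, 0, 3, 0],
    ![-1, -1, -1, 1, 0, 1, 0, 0, 1, 0],
    ![-(r : ℤ), -((2 * r + 2 : ℕ) : ℤ), 0, -2, ((3 * r + 4 : ℕ) : ℤ), 0, 0, 0, 0, 0],
    ![0, -(r : ℤ), -((2 * r + 2 : ℕ) : ℤ), 0, 0, -2, ((3 * r + 4 : ℕ) : ℤ), 0, 0, 0],
    ![-((2 * r + 2 : ℕ) : ℤ), 0, -(r : ℤ), 0, 0, 0, 0, ((3 * r + 4 : ℕ) : ℤ), -2, 0],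
    ![-(r : ℤ), -(r : ℤ), -((r + 1 : ℕ) : ℤ), -2, 0, -1, 0, 0, 0, ((3 * r + 4 : ℕ) : ℤ)]]

lemma aux14u_mem (r : ℕ) (i : Fin 8) : (∑ j, aux14u r i j • veroneseA j) = 0 := by
  funext k
  fin_cases i <;> fin_cases k <;>
    simp [aux14u, veroneseA, Fin.sum_univ_succ] <;> ring

lemma aux14_map {R F : Type*} [Field R] [Field F] (φ : MvPolynomial (Fin 10) R →+* F)
    (d : Fin 10 →₀ ℕ) : φ (monomial d 1) = ∏ j, φ (X j) ^ d j := by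
  rw [monomial_eq, C_1, one_mul, Finsupp.prod_fintype _ _ (by simp), map_prod]
  simp

/-- Points in the image of the monomial parametrization satisfy all toric relations. -/
lemma aux14_toric {K F : Type*} [Field K] [Field F] (φ : MvPolynomial (Fin 10) K →+* F)
    (t : Fin 3 → F) (B : Fin 10 → Fin 3 → ℕ) (hB : ∀ i k, (B i k : ℤ) = veroneseA i k)
    (ht : ∀ j, φ (X j) = ∏ k, t k ^ B j k)
    (u : Fin 10 → ℤ) (hu : (∑ i, u i • veroneseA i) = 0) :
    φ (monomial (pp u) (1 : K) - monomial (np u) 1) = 0 := by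
  have key : ∀ d : Fin 10 →₀ ℕ, φ (monomial d 1) = ∏ k, t k ^ (∑ j, B j k * d j) := by
    intro d
    rw [aux14_map]
    simp_rw [ht, ← Finset.prod_pow, ← pow_mul]
    rw [Finset.prod_comm]
    simp_rw [Finset.prod_pow_eq_pow_sum]
  rw [map_sub, key, key, sub_eq_zero]
  refine Finset.prod_congr rfl fun k _ => ?_
  congr 1
  have h := congrFun hu k
  simp only [Finset.sum_apply, Pi.smul_apply, smul_eq_mul, Pi.zero_apply] at h
  zify
  rw [← sub_eq_zero, ← Finset.sum_sub_distrib, ← h]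
  refine Finset.sum_congr rfl fun j _ => ?_
  rw [hB, ← mul_sub, mul_comm]
  congr 1
  simp only [pp, np, Finsupp.equivFunOnFinite_symm_apply_apply]
  omega

/-- The configuration, with natural number entries. -/
def aux14B : Fin 10 → Fin 3 → ℕ :=
  ![![3,0,0], ![0,3,0], ![0,0,3], ![2,1,0], ![1,2,0],
    ![0,2,1], ![0,1,2], ![2,0,1], ![1,0,2], ![1,1,1]]

lemma aux14B_eq (i : Fin 10) (k : Fin 3) : (aux14B i k : ℤ) = veroneseA i k := by
  revert i k
  decide

lemma aux14_pt {F : Type*} [Field F] [IsAlgClosed F] {r q : ℕ} (hq : q = 3 * r + 4)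
    (hinj : ∀ x y : F, x ^ q = y ^ q → x = y) (x : Fin 10 → F)
    (hh : ∀ i, ∏ j, x j ^ (aux14u r i j).toNat = ∏ j, x j ^ (-aux14u r i j).toNat) :
    ∃ t : Fin 3 → F, ∀ j, x j = ∏ k, t k ^ aux14B j k := by
  have T1 : (-2 + -(2 * (r : ℤ))).toNat = 0 := by omega
  have T2 : (-4 + -(3 * (r : ℤ))).toNat = 0 := by omega
  have T3 : (-1 + -(r : ℤ)).toNat = 0 := by omega
  have T4 : (2 * (r : ℤ) + 2).toNat = 2 * r + 2 := by omega
  have T5 : (3 * (r : ℤ) + 4).toNat = q := by omega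
  have g0 := hh 0
  have g1 := hh 1
  have g2 := hh 2
  have g3 := hh 3
  have g4 := hh 4
  have g5 := hh 5
  have g6 := hh 6
  have g7 := hh 7
  clear hh
  simp [aux14u, Fin.prod_univ_succ, T1, T2, T3, T4, T5] at g0 g1 g2 g3 g4 g5 g6 g7
  obtain ⟨a, b, c, k0, k1, k2, k3, k4, k5, k6, k7, k8, k9⟩ := aux14_param hq hinj
    (A := x 0) (B := x 1) (C := x 2) (x4 := x 3) (x5 := x 4) (x6 := x 5) (x7 := x 6)
    (x8 := x 7) (x9 := x 8) (x10 := x 9) g0 g1 (by rw [g2]; ring)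
    (by rw [mul_assoc, g3]; ring) (by rw [g4]; ring) (by rw [g5]; ring) (by rw [g6]; ring)
    (by rw [g7]; ring)
  refine ⟨![a, b, c], fun j => ?_⟩
  fin_cases j <;> simp [aux14B, Fin.prod_univ_succ] <;>
    first
    | exact k0
    | exact k1
    | exact k2
    | exact k3
    | exact k4
    | exact k5
    | exact k6
    | exact k7
    | exact k8
    | (rw [k9]; ring)

lemma aux14_ring {K : Type*} [Field K] {p r : ℕ} [Fact p.Prime] [CharP K p]
    (hr : p ^ 2 = 3 * r + 4) (P : Ideal (MvPolynomial (Fin 10) K)) [hP : P.IsPrime]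
    (h : ∀ i, monomial (pp (aux14u r i)) (1 : K) - monomial (np (aux14u r i)) 1 ∈ P)
    (u : Fin 10 → ℤ) (hu : (∑ i, u i • veroneseA i) = 0) :
    monomial (pp u) (1 : K) - monomial (np u) 1 ∈ P := by
  let Q := MvPolynomial (Fin 10) K ⧸ P
  let F := AlgebraicClosure (FractionRing Q)
  let ψ : Q →+* F := (algebraMap (FractionRing Q) F).comp (algebraMap Q (FractionRing Q))
  have hψ : Function.Injective ψ :=
    (algebraMap (FractionRing Q) F).injective.comp (IsFractionRing.injective Q (FractionRing Q))
  let φ : MvPolynomial (Fin 10) K →+* F := ψ.comp (Ideal.Quotient.mk P)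
  have hφ : ∀ f, φ f = 0 ↔ f ∈ P := by
    intro f
    rw [← Ideal.Quotient.eq_zero_iff_mem]
    exact map_eq_zero_iff ψ hψ
  have : CharP F p := charP_of_injective_ringHom (φ.comp (C : K →+* _)).injective p
  have hinj : ∀ x y : F, x ^ (p ^ 2) = y ^ (p ^ 2) → x = y := by
    intro x y hxy
    exact iterateFrobenius_inj F p 2 (by simpa [iterateFrobenius_def] using hxy)
  have hh : ∀ i, ∏ j, φ (X j) ^ (aux14u r i j).toNat = ∏ j, φ (X j) ^ (-aux14u r i j).toNat := by
    intro i
    have := (hφ _).2 (h i)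
    rw [map_sub, aux14_map, aux14_map, sub_eq_zero] at this
    exact this
  obtain ⟨t, ht⟩ := aux14_pt hr hinj (fun j => φ (X j)) hh
  exact (hφ _).1 (aux14_toric φ t aux14B aux14B_eq ht u hu)

/-- in characteristic `p > 0`, `p ≠ 3`, the toric ideal of the `(3,3)`-Veronese
configuration is generated up to radical by `8` binomials. -/
theorem statement14 {K : Type*} [Field K] {p : ℕ} [CharP K p] (hp : 0 < p) (hp3 : p ≠ 3) :
    bar (toricIdeal K veroneseA) ≤ 8 := by
  have hprime : p.Prime := (CharP.char_is_prime_or_zero K p).resolve_right hp.ne'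
  have : Fact p.Prime := ⟨hprime⟩
  have h3 : p % 3 ≠ 0 := by
    intro h
    exact hp3 (((Nat.prime_dvd_prime_iff_eq Nat.prime_three hprime).1
      (Nat.dvd_of_mod_eq_zero h)).symm)
  obtain ⟨r, hr⟩ : ∃ r, p ^ 2 = 3 * r + 4 := by
    have h4 : 4 ≤ p ^ 2 := by nlinarith [hprime.two_le]
    have hm : p ^ 2 % 3 = 1 := by
      have : p % 3 = 1 ∨ p % 3 = 2 := by omega
      rcases this with h | h <;> simp [Nat.pow_mod, h]
    exact ⟨(p ^ 2 - 4) / 3, by omega⟩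
  refine Nat.sInf_le ⟨fun i => monomial (pp (aux14u r i)) (1 : K) - monomial (np (aux14u r i)) 1,
    fun i => ⟨Ideal.subset_span ⟨_, aux14u_mem r i, rfl⟩, pp (aux14u r i), np (aux14u r i), 1, -1,
      by simp only [sub_eq_add_neg, map_neg]⟩, le_antisymm ?_ ?_⟩
  · apply Ideal.radical_mono
    rw [Ideal.span_le]
    rintro _ ⟨i, rfl⟩
    exact Ideal.subset_span ⟨_, aux14u_mem r i, rfl⟩
  · rw [Ideal.radical_le_radical_iff, toricIdeal, Ideal.span_le]
    rintro _ ⟨u, hu, rfl⟩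
    rw [SetLike.mem_coe, Ideal.radical_eq_sInf, Ideal.mem_sInf]
    rintro P ⟨hle, hP⟩
    exact aux14_ring hr P (fun i => hle (Ideal.subset_span ⟨i, rfl⟩)) u hu

end LatticePaper
end

section
/- For every integer m ≥ 8, the sublattice L(m) of ℤ⁴ generated by e₁ = (m+2q−3, −m+2q+5, −1, −1), e₂ = (−m−2q+5, m−2q−3, −1, −1), e₃ = (−m−2q+5, −1, m−3, −1), where q = 0 if m is even and q = 1 if m is odd, has rank 3 and is not saturated: (2,2,−2,−2) = e₁ + e₂ ∈ L(m) but (1,1,−1,−1) ∉ L(m). Consequently, for any field K, the lattice ideal I_{L(m),1} ⊂ K[x₁,…,x₄] has height 3 and is never a toric (prime) ideal. -/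
open MvPolynomial

namespace LatticePaper

theorem Lm_comb {m q : ℕ} {v : Fin 4 → ℤ} (hv : v ∈ Lm m q) :
    ∃ a b c : ℤ, v = a • e1v m q + b • e2v m q + c • e3v m q := by
  unfold Lm at hv
  induction hv using AddSubgroup.closure_induction with
  | mem x hx =>
    rcases hx with rfl | rfl | rfl
    · exact ⟨1, 0, 0, by simp⟩
    · exact ⟨0, 1, 0, by simp⟩
    · exact ⟨0, 0, 1, by simp⟩
  | zero => exact ⟨0, 0, 0, by simp⟩
  | add x y _ _ hx hy =>
    obtain ⟨a, b, c, rfl⟩ := hx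
    obtain ⟨a', b', c', rfl⟩ := hy
    exact ⟨a + a', b + b', c + c', by simp only [add_smul]; abel⟩
  | neg x _ hx =>
    obtain ⟨a, b, c, rfl⟩ := hx
    exact ⟨-a, -b, -c, by simp only [neg_smul]; abel⟩

/-- Solving the linear system for `t • (1,1,-1,-1)`. -/
theorem comb_solve {m q : ℕ} (hm : 8 ≤ m) (a b c t : ℤ)
    (h : a • e1v m q + b • e2v m q + c • e3v m q = ![t, t, -t, -t]) :
    c = 0 ∧ a = b ∧ a + b = t := by
  have h0 := congrFun h 0
  have h2 := congrFun h 2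
  have h3 := congrFun h 3
  simp [e1v, e2v, e3v] at h0 h2 h3
  have hm' : (8 : ℤ) ≤ m := by exact_mod_cast hm
  have hq' : (0 : ℤ) ≤ q := Int.natCast_nonneg q
  have hc : c * ((m : ℤ) - 2) = 0 := by linear_combination h2 - h3
  have hc0 : c = 0 := by
    rcases mul_eq_zero.1 hc with h | h
    · exact h
    · omega
  subst hc0
  have hab : a + b = t := by linarith
  have hd : (a - b) * ((m : ℤ) + 2 * q - 4) = 0 := by linear_combination h0 - hab
  refine ⟨rfl, ?_, hab⟩
  rcases mul_eq_zero.1 hd with h | h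
  · omega
  · omega

theorem ones_not_mem {m q : ℕ} (hm : 8 ≤ m) : (![1, 1, -1, -1] : Fin 4 → ℤ) ∉ Lm m q := by
  intro h
  obtain ⟨a, b, c, h⟩ := Lm_comb h
  obtain ⟨_, h1, h2⟩ := comb_solve hm a b c 1 h.symm
  omega

theorem e_add (m q : ℕ) : e1v m q + e2v m q = ![2, 2, -2, -2] := by
  ext i
  fin_cases i <;> simp [e1v, e2v] <;> ring

theorem twos_mem (m q : ℕ) : (![2, 2, -2, -2] : Fin 4 → ℤ) ∈ Lm m q := by
  rw [← e_add m q]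
  exact add_mem (AddSubgroup.subset_closure (by simp)) (AddSubgroup.subset_closure (by simp))

theorem rank_Lm {m q : ℕ} (hm : 8 ≤ m) : latRank (Lm m q) = 3 := by
  have hli : LinearIndependent ℤ ![e1v m q, e2v m q, e3v m q] := by
    rw [Fintype.linearIndependent_iff]
    intro g hg
    have h0 : g 0 • e1v m q + g 1 • e2v m q + g 2 • e3v m q = ![0, 0, -0, -0] := by
      rw [Fin.sum_univ_three] at hg
      refine Eq.trans hg ?_
      ext i
      fin_cases i <;> rfl
    obtain ⟨h1, h2, h3⟩ := comb_solve hm _ _ _ 0 h0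
    intro i
    fin_cases i <;> simp <;> omega
  have hs : AddSubgroup.toIntSubmodule (Lm m q) =
      Submodule.span ℤ (Set.range ![e1v m q, e2v m q, e3v m q]) := by
    apply Submodule.toAddSubgroup_injective
    rw [Submodule.span_int_eq_addSubgroupClosure]
    have hr : Set.range ![e1v m q, e2v m q, e3v m q] = {e1v m q, e2v m q, e3v m q} := by
      ext x
      simp
      tauto
    rw [hr]
    rfl
  unfold latRank
  rw [hs, finrank_span_eq_card hli]
  simp

/-- The grading map to the group algebra of `ℤ⁴ / L`. -/
noncomputable def quotMap (K : Type*) [Field K] (L : AddSubgroup (Fin 4 → ℤ)) :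
    MvPolynomial (Fin 4) K →ₐ[K] AddMonoidAlgebra K ((Fin 4 → ℤ) ⧸ L) :=
  aeval fun i => AddMonoidAlgebra.single (QuotientAddGroup.mk (Pi.single i 1)) 1

theorem quotMap_monomial (K : Type*) [Field K] (L : AddSubgroup (Fin 4 → ℤ)) (d : Fin 4 →₀ ℕ) :
    quotMap K L (monomial d 1) =
      AddMonoidAlgebra.single (QuotientAddGroup.mk fun i => (d i : ℤ)) 1 := by
  unfold quotMap
  rw [aeval_monomial, Finsupp.prod_fintype _ _ (by simp)]
  simp only [Fin.prod_univ_four, AddMonoidAlgebra.single_pow, AddMonoidAlgebra.single_mul_single,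
    map_one, one_mul, one_pow, ← QuotientAddGroup.mk_nsmul, ← QuotientAddGroup.mk_add]
  congr 2
  ext i
  fin_cases i <;> simp

theorem quotMap_zero {K : Type*} [Field K] {L : AddSubgroup (Fin 4 → ℤ)}
    {f : MvPolynomial (Fin 4) K} (hf : f ∈ latIdeal1 K L) : quotMap K L f = 0 := by
  have : latIdeal1 K L ≤ RingHom.ker (quotMap K L) := by
    unfold latIdeal1
    rw [Ideal.span_le]
    rintro _ ⟨u, hu, rfl⟩
    simp only [SetLike.mem_coe, RingHom.mem_ker, map_sub, quotMap_monomial, sub_eq_zero]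
    congr 1
    rw [QuotientAddGroup.eq]
    convert neg_mem hu using 1
    ext i
    simp [pp, np]
    omega
  exact this hf

theorem not_mem_aux {K : Type*} [Field K] {L : AddSubgroup (Fin 4 → ℤ)} (c : K)
    (hL : (![1, 1, -1, -1] : Fin 4 → ℤ) ∉ L) :
    X 0 * X 1 + C c * (X 2 * X 3) ∉ latIdeal1 K L := by
  intro h
  have h := quotMap_zero h
  simp only [quotMap, map_add, map_mul, aeval_X, AddMonoidAlgebra.single_mul_single,
    algHom_C, AddMonoidAlgebra.coe_algebraMap, Function.comp, one_mul, mul_one,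
    ← QuotientAddGroup.mk_add, zero_add, Algebra.algebraMap_self_apply] at h
  have hne : (QuotientAddGroup.mk (Pi.single 2 1 + Pi.single 3 1) : (Fin 4 → ℤ) ⧸ L) ≠
      QuotientAddGroup.mk (Pi.single 0 1 + Pi.single 1 1) := by
    rw [Ne, QuotientAddGroup.eq]
    convert hL using 2
    ext i
    fin_cases i <;> simp
  have h' := DFunLike.congr_fun (congrArg AddMonoidAlgebra.coeff h)
    (QuotientAddGroup.mk (Pi.single 0 1 + Pi.single 1 1))
  rw [AddMonoidAlgebra.coeff_add, Finsupp.add_apply, AddMonoidAlgebra.coeff_single,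
    AddMonoidAlgebra.coeff_single, Finsupp.single_eq_same, Finsupp.single_eq_of_ne hne.symm] at h'
  simp at h'

theorem not_prime_aux {K : Type*} [Field K] {L : AddSubgroup (Fin 4 → ℤ)}
    (hL : (![1, 1, -1, -1] : Fin 4 → ℤ) ∉ L) (hL2 : (![2, 2, -2, -2] : Fin 4 → ℤ) ∈ L) :
    ¬ (latIdeal1 K L).IsPrime := by
  intro hp
  have hmem : (X 0 * X 1 + C (1 : K) * (X 2 * X 3)) * (X 0 * X 1 + C (-1 : K) * (X 2 * X 3))
      ∈ latIdeal1 K L := by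
    apply Ideal.subset_span
    refine ⟨_, hL2, ?_⟩
    rw [monomial_eq, monomial_eq, Finsupp.prod_fintype _ _ (by simp),
      Finsupp.prod_fintype _ _ (by simp)]
    simp [Fin.prod_univ_four, pp, np]
    ring
  rcases hp.mem_or_mem hmem with h | h
  · exact not_mem_aux _ hL h
  · exact not_mem_aux _ hL h

/-- for `m ≥ 8`, the lattice `L(m)` has rank `3` and is not saturated:
`(2,2,-2,-2) = e₁ + e₂ ∈ L(m)` while `(1,1,-1,-1) ∉ L(m)`; hence for any field `K` the
lattice ideal `I_{L(m),1}` has height `3` (= rank `L(m)`) and is never prime (toric). -/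
theorem statement15 (m q : ℕ) (hm : 8 ≤ m)
    (hq : (Even m ∧ q = 0) ∨ (¬ Even m ∧ q = 1)) :
    latRank (Lm m q) = 3 ∧
    e1v m q + e2v m q = ![2, 2, -2, -2] ∧
    (![2, 2, -2, -2] : Fin 4 → ℤ) ∈ Lm m q ∧
    (![1, 1, -1, -1] : Fin 4 → ℤ) ∉ Lm m q ∧
    ∀ (K : Type*) [Field K], ¬ (latIdeal1 K (Lm m q)).IsPrime := by
  exact ⟨rank_Lm hm, e_add m q, twos_mem m q, ones_not_mem hm,
    fun K _ => not_prime_aux (ones_not_mem hm) (twos_mem m q)⟩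

end LatticePaper
end

section
/- For every integer m ≥ 8 with q = 0 if m is even and q = 1 if m is odd, the saturation of the sublattice L(m) of ℤ⁴ generated by e₁ = (m+2q−3, −m+2q+5, −1, −1), e₂ = (−m−2q+5, m−2q−3, −1, −1), e₃ = (−m−2q+5, −1, m−3, −1) equals the kernel of the homomorphism φ_m : ℤ⁴ → ℤ defined by φ_m(a,b,c,d) = a+b+c+d if m is even and φ_m(a,b,c,d) = a(m−6) + b(m−2) + c(m−4) + d(m−4) if m is odd. -/
open MvPolynomial

namespace LatticePaper

/-- A linear form vanishing on the generators and at `d • α` vanishes at `α`. -/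
theorem aux_forward (m q : ℕ) (a b c e : ℤ)
    (h1 : e1v m q 0 * a + e1v m q 1 * b + e1v m q 2 * c + e1v m q 3 * e = 0)
    (h2 : e2v m q 0 * a + e2v m q 1 * b + e2v m q 2 * c + e2v m q 3 * e = 0)
    (h3 : e3v m q 0 * a + e3v m q 1 * b + e3v m q 2 * c + e3v m q 3 * e = 0)
    (α : Fin 4 → ℤ) (h : ∃ d : ℤ, d ≠ 0 ∧ d • α ∈ Lm m q) :
    α 0 * a + α 1 * b + α 2 * c + α 3 * e = 0 := by
  obtain ⟨d, hd, hmem⟩ := h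
  have key : ∀ u ∈ Lm m q, u 0 * a + u 1 * b + u 2 * c + u 3 * e = 0 := by
    intro u hu
    unfold Lm at hu
    induction hu using AddSubgroup.closure_induction with
    | mem x hx =>
      rcases hx with rfl | rfl | rfl
      · exact h1
      · exact h2
      · exact h3
    | zero => simp
    | add x y _ _ hx hy => simp only [Pi.add_apply]; linear_combination hx + hy
    | neg x _ hx => simp only [Pi.neg_apply]; linear_combination -hx
  have := key _ hmem
  simp only [Pi.smul_apply, smul_eq_mul] at this
  apply mul_left_cancel₀ hd
  linear_combination this

theorem aux_mem (m q : ℕ) (x y z : ℤ) (u : Fin 4 → ℤ)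
    (h : u = x • e1v m q + y • e2v m q + z • e3v m q) : u ∈ Lm m q := by
  rw [h]
  refine add_mem (add_mem ?_ ?_) ?_ <;> apply zsmul_mem <;> apply AddSubgroup.subset_closure <;> simp

/-- for `m ≥ 8`, the saturation of `L(m)` equals the kernel of `φ_m`, where
`φ_m(a,b,c,d) = a+b+c+d` if `m` is even and
`φ_m(a,b,c,d) = a(m-6)+b(m-2)+c(m-4)+d(m-4)` if `m` is odd. -/
theorem statement16 (m q : ℕ) (hm : 8 ≤ m)
    (hq : (Even m ∧ q = 0) ∨ (¬ Even m ∧ q = 1)) :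
    (Even m → ∀ α : Fin 4 → ℤ,
      ((∃ d : ℤ, d ≠ 0 ∧ d • α ∈ Lm m q) ↔ α 0 + α 1 + α 2 + α 3 = 0)) ∧
    (¬ Even m → ∀ α : Fin 4 → ℤ,
      ((∃ d : ℤ, d ≠ 0 ∧ d • α ∈ Lm m q) ↔
        α 0 * ((m : ℤ) - 6) + α 1 * ((m : ℤ) - 2) +
          α 2 * ((m : ℤ) - 4) + α 3 * ((m : ℤ) - 4) = 0)) := by
  constructor
  · intro hev α
    obtain rfl : q = 0 := by tauto
    constructor
    · intro h
      have := aux_forward m 0 1 1 1 1 (by simp [e1v]; ring) (by simp [e2v]; ring)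
        (by simp [e3v]; ring) α h
      linear_combination this
    · intro h
      have hn : (8 : ℤ) ≤ m := by exact_mod_cast hm
      obtain ⟨n, hn'⟩ : ∃ n : ℤ, n = (m : ℤ) - 3 := ⟨_, rfl⟩
      have hmn : (m : ℤ) = n + 3 := by omega
      have hD : (n + 1) * (2 * n - 2) ≠ 0 :=
        mul_ne_zero (by omega) (by omega)
      refine ⟨(n + 1) * (2 * n - 2), hD, ?_⟩
      obtain ⟨z, hz⟩ : ∃ z : ℤ, z = (2 * n - 2) * (α 2 - α 3) := ⟨_, rfl⟩
      obtain ⟨x, hx⟩ : ∃ x : ℤ, x = (n - 0) * (-(α 2 - α 3) - (n + 1) * α 3) - (α 2 - α 3)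
        - (n + 1) * α 1 := ⟨_, rfl⟩
      obtain ⟨y, hy⟩ : ∃ y : ℤ, y = -z - (n + 1) * (2 * n - 2) * α 3 - x := ⟨_, rfl⟩
      apply aux_mem m 0 x y z
      try rw [hmn] at h
      ext i
      fin_cases i
      · simp [e1v, e2v, e3v, hmn]
        subst hy hx hz
        linear_combination (n + 1) * (2 * n - 2) * h
      · simp [e1v, e2v, e3v, hmn]
        subst hy hx hz
        ring
      · simp [e1v, e2v, e3v, hmn]
        subst hy hx hz
        ring
      · simp [e1v, e2v, e3v, hmn]
        subst hy hx hz
        ring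
  · intro hev α
    obtain rfl : q = 1 := by tauto
    constructor
    · intro h
      exact aux_forward m 1 ((m : ℤ) - 6) ((m : ℤ) - 2) ((m : ℤ) - 4) ((m : ℤ) - 4)
        (by simp [e1v]; ring) (by simp [e2v]; ring) (by simp [e3v]; ring) α h
    · intro h
      have hn : (8 : ℤ) ≤ m := by exact_mod_cast hm
      obtain ⟨n, hn'⟩ : ∃ n : ℤ, n = (m : ℤ) - 3 := ⟨_, rfl⟩
      have hmn : (m : ℤ) = n + 3 := by omega
      have hD : (n + 1) * (2 * n - 6) ≠ 0 :=
        mul_ne_zero (by omega) (by omega)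
      refine ⟨(n + 1) * (2 * n - 6), hD, ?_⟩
      obtain ⟨z, hz⟩ : ∃ z : ℤ, z = (2 * n - 6) * (α 2 - α 3) := ⟨_, rfl⟩
      obtain ⟨x, hx⟩ : ∃ x : ℤ, x = (n - 2) * (-(α 2 - α 3) - (n + 1) * α 3) - (α 2 - α 3)
        - (n + 1) * α 1 := ⟨_, rfl⟩
      obtain ⟨y, hy⟩ : ∃ y : ℤ, y = -z - (n + 1) * (2 * n - 6) * α 3 - x := ⟨_, rfl⟩
      apply aux_mem m 1 x y z
      try rw [hmn] at h
      ext i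
      fin_cases i
      · simp [e1v, e2v, e3v, hmn]
        have h6 : n - 3 ≠ 0 := by omega
        apply mul_left_cancel₀ h6
        subst hy hx hz
        linear_combination (n + 1) * (2 * n - 6) * h
      · simp [e1v, e2v, e3v, hmn]
        subst hy hx hz
        ring
      · simp [e1v, e2v, e3v, hmn]
        subst hy hx hz
        ring
      · simp [e1v, e2v, e3v, hmn]
        subst hy hx hz
        ring

end LatticePaper
end

section
/- Let K be a field of characteristic zero and m ≥ 8 an integer, with q = 0 if m is even and q = 1 if m is odd. Let L(m) ⊂ ℤ⁴ be the sublattice generated by e₁ = (m+2q−3, −m+2q+5, −1, −1), e₂ = (−m−2q+5, m−2q−3, −1, −1), e₃ = (−m−2q+5, −1, m−3, −1). Then rad(I_{L(m),1}) = rad(f₁, f₂, f₃, f₁₂₃), where f₁ = x₁^{m+2q−3} − x₂^{m−2q−5}x₃x₄, f₂ = x₂^{m−2q−3} − x₁^{m+2q−5}x₃x₄, f₃ = x₃^{m−3} − x₁^{m+2q−5}x₂x₄, and f₁₂₃ = x₄^{m−3} − x₁x₂^{m−5}x₃ if m is even, f₁₂₃ = x₄^{m−3} − x₁^{m−3}x₂x₃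 if m is odd. In particular I_{L(m),1} is an almost set-theoretic complete intersection: ara(I_{L(m),1}) ≤ 4 = h(I_{L(m),1}) + 1. -/
open MvPolynomial

namespace LatticePaper

lemma mono4 {K F : Type*} [Field K] [CommRing F] (φ : MvPolynomial (Fin 4) K →+* F)
    (s : Fin 4 →₀ ℕ) :
    φ (monomial s 1) = φ (X 0) ^ s 0 * φ (X 1) ^ s 1 * φ (X 2) ^ s 2 * φ (X 3) ^ s 3 := by
  rw [monomial_eq]
  simp [Finsupp.prod_fintype, Fin.prod_univ_four]

lemma binom_mem {K : Type*} [Field K] (L : AddSubgroup (Fin 4 → ℤ)) (u : Fin 4 → ℤ) (hu : u ∈ L)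
    (f : MvPolynomial (Fin 4) K)
    (h : f = X 0 ^ (u 0).toNat * X 1 ^ (u 1).toNat * X 2 ^ (u 2).toNat * X 3 ^ (u 3).toNat
      - X 0 ^ (-u 0).toNat * X 1 ^ (-u 1).toNat * X 2 ^ (-u 2).toNat * X 3 ^ (-u 3).toNat) :
    f ∈ latIdeal1 K L := by
  apply Ideal.subset_span
  refine ⟨u, hu, ?_⟩
  have h1 := mono4 (RingHom.id (MvPolynomial (Fin 4) K)) (pp u)
  have h2 := mono4 (RingHom.id (MvPolynomial (Fin 4) K)) (np u)
  simp only [RingHom.id_apply] at h1 h2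
  rw [h, h1, h2]
  rfl

lemma zpow_toNat {F : Type*} [Field F] (a : F) (ha : a ≠ 0) (n : ℤ) :
    a ^ n.toNat = a ^ n * a ^ (-n).toNat := by
  rw [← zpow_natCast, ← zpow_natCast, ← zpow_add₀ ha]
  congr 1
  omega

lemma e_pos {m q : ℕ} (hm : 8 ≤ m) (hq : q ≤ 1) (hq' : q = 1 → 9 ≤ m) (u : Fin 4 → ℤ)
    (hu : u ∈ Lm m q) :
    ((m : ℤ) - 2 - 4 * q) * u 0 + ((m : ℤ) - 2) * u 1 + ((m : ℤ) - 2 - 2 * q) * u 2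
      + ((m : ℤ) - 2 - 2 * q) * u 3 = 0 := by
  have hqq : (q : ℤ) = 0 ∨ (q : ℤ) = 1 := by omega
  induction hu using AddSubgroup.closure_induction with
  | mem x hx =>
    simp only [Set.mem_insert_iff, Set.mem_singleton_iff] at hx
    rcases hx with rfl | rfl | rfl <;> rcases hqq with h | h <;>
      simp [e1v, e2v, e3v, h] <;> ring
  | zero => simp
  | add x y _ _ hx hy => simp only [Pi.add_apply]; linear_combination hx + hy
  | neg x _ hx => simp only [Pi.neg_apply]; linear_combination -hx

lemma zero_case {F : Type*} [Field F] (a b c d : ℕ) :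
    (0 : F) ^ a * 0 ^ b * 0 ^ c * 0 ^ d = if a + b + c + d = 0 then 1 else 0 := by
  rw [← pow_add, ← pow_add, ← pow_add]
  split_ifs with h
  · rw [h, pow_zero]
  · exact zero_pow h

lemma all_zero {F : Type*} [Field F] {m q : ℕ} (hm : 8 ≤ m) (hq : q ≤ 1) (hq' : q = 1 → 9 ≤ m)
    (u : Fin 4 → ℤ) (hu : u ∈ Lm m q) :
    (0 : F) ^ (u 0).toNat * 0 ^ (u 1).toNat * 0 ^ (u 2).toNat * 0 ^ (u 3).toNat
      = 0 ^ (-u 0).toNat * 0 ^ (-u 1).toNat * 0 ^ (-u 2).toNat * 0 ^ (-u 3).toNat := by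
  rw [zero_case, zero_case]
  have h := e_pos hm hq hq' u hu
  have p0 : 0 < (m : ℤ) - 2 - 4 * q := by omega
  have p1 : 0 < (m : ℤ) - 2 := by omega
  have p2 : 0 < (m : ℤ) - 2 - 2 * q := by omega
  generalize (m : ℤ) - 2 - 4 * q = w0 at *
  generalize (m : ℤ) - 2 - 2 * q = w2 at *
  generalize (m : ℤ) - 2 = w1 at *
  have key : ∀ a b c d : ℤ, w0 * a + w1 * b + w2 * c + w2 * d = 0 → 0 ≤ a → 0 ≤ b → 0 ≤ c →
      0 ≤ d → a = 0 ∧ b = 0 ∧ c = 0 ∧ d = 0 := by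
    intro a b c d h ha hb hc hd
    have := mul_nonneg p0.le ha
    have := mul_nonneg p1.le hb
    have := mul_nonneg p2.le hc
    have := mul_nonneg p2.le hd
    have h0 : w0 * a = 0 := by linarith
    have h1 : w1 * b = 0 := by linarith
    have h2 : w2 * c = 0 := by linarith
    have h3 : w2 * d = 0 := by linarith
    refine ⟨?_, ?_, ?_, ?_⟩
    · exact (mul_eq_zero.1 h0).resolve_left p0.ne'
    · exact (mul_eq_zero.1 h1).resolve_left p1.ne'
    · exact (mul_eq_zero.1 h2).resolve_left p2.ne'
    · exact (mul_eq_zero.1 h3).resolve_left p2.ne'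
  have hiff : (u 0).toNat + (u 1).toNat + (u 2).toNat + (u 3).toNat = 0 ↔
      (-u 0).toNat + (-u 1).toNat + (-u 2).toNat + (-u 3).toNat = 0 := by
    constructor
    · intro hz
      have := key (-u 0) (-u 1) (-u 2) (-u 3) (by linarith) (by omega) (by omega) (by omega)
        (by omega)
      omega
    · intro hz
      have := key (u 0) (u 1) (u 2) (u 3) (by linarith) (by omega) (by omega) (by omega)
        (by omega)
      omega
  simp only [hiff]

/-- The key vanishing statement over a field. -/
lemma field_case {F : Type*} [Field F] {m q : ℕ} (hm : 8 ≤ m)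
    (hq : (Even m ∧ q = 0) ∨ (¬ Even m ∧ q = 1)) (a b c d : F)
    (h1 : a ^ (m + 2 * q - 3) = b ^ (m - 2 * q - 5) * c * d)
    (h2 : b ^ (m - 2 * q - 3) = a ^ (m + 2 * q - 5) * c * d)
    (h3 : c ^ (m - 3) = a ^ (m + 2 * q - 5) * b * d)
    (h4 : a = 0 → d = 0)
    (u : Fin 4 → ℤ) (hu : u ∈ Lm m q) :
    a ^ (u 0).toNat * b ^ (u 1).toNat * c ^ (u 2).toNat * d ^ (u 3).toNat
      = a ^ (-u 0).toNat * b ^ (-u 1).toNat * c ^ (-u 2).toNat * d ^ (-u 3).toNat := by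
  have hq1 : q ≤ 1 := by omega
  have hq' : q = 1 → 9 ≤ m := by
    rintro rfl
    rcases hq with h | h
    · omega
    · rw [Nat.not_even_iff_odd, Nat.odd_iff] at h
      omega
  by_cases ha : a = 0
  · have hd := h4 ha
    subst ha hd
    have hb : b = 0 := by
      rw [mul_zero] at h2
      exact eq_zero_of_pow_eq_zero h2
    have hc : c = 0 := by
      rw [mul_zero] at h3
      exact eq_zero_of_pow_eq_zero h3
    subst hb hc
    exact all_zero hm hq1 hq' u hu
  · have hne : b ^ (m - 2 * q - 5) * c * d ≠ 0 := h1 ▸ pow_ne_zero _ ha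
    have hd : d ≠ 0 := right_ne_zero_of_mul hne
    have hc : c ≠ 0 := right_ne_zero_of_mul (left_ne_zero_of_mul hne)
    have hb : b ≠ 0 := by
      intro hb
      apply hne
      rw [hb, zero_pow (by omega)]
      ring
    have key : a ^ u 0 * b ^ u 1 * c ^ u 2 * d ^ u 3 = 1 := by
      induction hu using AddSubgroup.closure_induction with
      | mem x hx =>
        simp only [Set.mem_insert_iff, Set.mem_singleton_iff] at hx
        rcases hx with rfl | rfl | rfl
        · have E0 : (m : ℤ) + 2 * q - 3 = ((m + 2 * q - 3 : ℕ) : ℤ) := by omega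
          have E1 : -(m : ℤ) + 2 * q + 5 = -((m - 2 * q - 5 : ℕ) : ℤ) := by omega
          simp only [e1v, Matrix.cons_val, E0, E1, zpow_neg, zpow_natCast, zpow_one, h1]
          field_simp
        · have E0 : -(m : ℤ) - 2 * q + 5 = -((m + 2 * q - 5 : ℕ) : ℤ) := by omega
          have E1 : (m : ℤ) - 2 * q - 3 = ((m - 2 * q - 3 : ℕ) : ℤ) := by omega
          simp only [e2v, Matrix.cons_val, E0, E1, zpow_neg, zpow_natCast, zpow_one, h2]
          field_simp
        · have E0 : -(m : ℤ) - 2 * q + 5 = -((m + 2 * q - 5 : ℕ) : ℤ) := by omega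
          have E1 : (m : ℤ) - 3 = ((m - 3 : ℕ) : ℤ) := by omega
          simp only [e3v, Matrix.cons_val, E0, E1, zpow_neg, zpow_natCast, zpow_one, h3]
          field_simp
      | zero => simp
      | add x y _ _ hx hy =>
        simp only [Pi.add_apply, zpow_add₀ ha, zpow_add₀ hb, zpow_add₀ hc, zpow_add₀ hd]
        linear_combination (a ^ y 0 * b ^ y 1 * c ^ y 2 * d ^ y 3) * hx + hy
      | neg x _ hx =>
        simp only [Pi.neg_apply, zpow_neg, ← mul_inv, hx, inv_one]
    rw [zpow_toNat a ha, zpow_toNat b hb, zpow_toNat c hc, zpow_toNat d hd]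
    linear_combination (a ^ (-u 0).toNat * b ^ (-u 1).toNat * c ^ (-u 2).toNat *
      d ^ (-u 3).toNat) * key

lemma span_le_lat {K : Type*} [Field K] (m q : ℕ) (hm : 8 ≤ m)
    (hq : (Even m ∧ q = 0) ∨ (¬ Even m ∧ q = 1)) :
    ∀ f ∈ ({fpoly1 K m q, fpoly2 K m q, fpoly3 K m q, fpoly123 K m} :
      Set (MvPolynomial (Fin 4) K)), f ∈ latIdeal1 K (Lm m q) := by
  have m1 : e1v m q ∈ Lm m q := AddSubgroup.subset_closure (by simp)
  have m2 : e2v m q ∈ Lm m q := AddSubgroup.subset_closure (by simp)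
  have m3 : e3v m q ∈ Lm m q := AddSubgroup.subset_closure (by simp)
  have hq1 : q ≤ 1 := by omega
  have t1 : (-1 : ℤ).toNat = 0 := rfl
  have t2 : (1 : ℤ).toNat = 1 := rfl
  have hq' : q = 1 → 9 ≤ m := by
    rintro rfl
    rcases hq with h | h
    · omega
    · rw [Nat.not_even_iff_odd, Nat.odd_iff] at h
      omega
  intro f hf
  simp only [Set.mem_insert_iff, Set.mem_singleton_iff] at hf
  rcases hf with rfl | rfl | rfl | rfl
  · apply binom_mem _ _ m1
    have E0 : ((m : ℤ) + 2 * q - 3).toNat = m + 2 * q - 3 := by omega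
    have E1 : (-(m : ℤ) + 2 * q + 5).toNat = 0 := by omega
    have E2 : (-((m : ℤ) + 2 * q - 3)).toNat = 0 := by omega
    have E3 : (-(-(m : ℤ) + 2 * q + 5)).toNat = m - 2 * q - 5 := by omega
    simp only [e1v, Matrix.cons_val, E0, E1, E2, E3, t1, t2, neg_neg, pow_zero, pow_one,
      one_mul, mul_one, fpoly1]
  · apply binom_mem _ _ m2
    have E0 : (-(m : ℤ) - 2 * q + 5).toNat = 0 := by omega
    have E1 : ((m : ℤ) - 2 * q - 3).toNat = m - 2 * q - 3 := by omega
    have E2 : (-(-(m : ℤ) - 2 * q + 5)).toNat = m + 2 * q - 5 := by omega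
    have E3 : (-((m : ℤ) - 2 * q - 3)).toNat = 0 := by omega
    simp only [e2v, Matrix.cons_val, E0, E1, E2, E3, t1, t2, neg_neg, pow_zero, pow_one,
      one_mul, mul_one, fpoly2]
  · apply binom_mem _ _ m3
    have E0 : (-(m : ℤ) - 2 * q + 5).toNat = 0 := by omega
    have E1 : ((m : ℤ) - 3).toNat = m - 3 := by omega
    have E2 : (-(-(m : ℤ) - 2 * q + 5)).toNat = m + 2 * q - 5 := by omega
    have E3 : (-((m : ℤ) - 3)).toNat = 0 := by omega
    simp only [e3v, Matrix.cons_val, E0, E1, E2, E3, t1, t2, neg_neg, pow_zero, pow_one,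
      one_mul, mul_one, fpoly3]
  · have F1 : ((m : ℤ) - 3).toNat = m - 3 := by omega
    have F2 : (-((m : ℤ) - 3)).toNat = 0 := by omega
    have F3 : ((m : ℤ) - 5).toNat = m - 5 := by omega
    have F4 : (-((m : ℤ) - 5)).toNat = 0 := by omega
    rcases hq with ⟨he, rfl⟩ | ⟨he, rfl⟩
    · have hv : (![-1, -((m : ℤ) - 5), -1, (m : ℤ) - 3] : Fin 4 → ℤ) ∈ Lm m 0 := by
        obtain ⟨k, hk⟩ := he
        have : (![-1, -((m : ℤ) - 5), -1, (m : ℤ) - 3] : Fin 4 → ℤ) =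
            (2 - k : ℤ) • e1v m 0 + (2 - k : ℤ) • e2v m 0 - e3v m 0 := by
          funext i
          fin_cases i <;> simp [e1v, e2v, e3v, hk] <;> ring
        rw [this]
        exact sub_mem (add_mem (zsmul_mem m1 _) (zsmul_mem m2 _)) m3
      apply binom_mem _ _ hv
      simp only [Matrix.cons_val, F1, F2, F3, F4, t1, t2, neg_neg, pow_zero, pow_one,
        one_mul, mul_one, fpoly123, if_pos he]
    · have hv : (![-((m : ℤ) - 3), -1, -1, (m : ℤ) - 3] : Fin 4 → ℤ) ∈ Lm m 1 := by
        obtain ⟨k, hk⟩ := Nat.not_even_iff_odd.1 he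
        have : (![-((m : ℤ) - 3), -1, -1, (m : ℤ) - 3] : Fin 4 → ℤ) =
            (1 - k : ℤ) • e1v m 1 + (2 - k : ℤ) • e2v m 1 - e3v m 1 := by
          funext i
          fin_cases i <;> simp [e1v, e2v, e3v, hk] <;> ring
        rw [this]
        exact sub_mem (add_mem (zsmul_mem m1 _) (zsmul_mem m2 _)) m3
      apply binom_mem _ _ hv
      simp only [Matrix.cons_val, F1, F2, t1, t2, neg_neg, pow_zero, pow_one,
        one_mul, mul_one, fpoly123, if_neg he]

lemma lat_le_radical {K : Type*} [Field K] (m q : ℕ) (hm : 8 ≤ m)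
    (hq : (Even m ∧ q = 0) ∨ (¬ Even m ∧ q = 1)) :
    latIdeal1 K (Lm m q) ≤
      (Ideal.span {fpoly1 K m q, fpoly2 K m q, fpoly3 K m q, fpoly123 K m}).radical := by
  rw [Ideal.radical_eq_sInf]
  refine le_sInf ?_
  rintro P ⟨hP, hprime⟩
  rw [Ideal.span_le] at hP
  rw [latIdeal1, Ideal.span_le]
  rintro _ ⟨u, hu, rfl⟩
  let φ : MvPolynomial (Fin 4) K →+* FractionRing (MvPolynomial (Fin 4) K ⧸ P) :=
    (algebraMap (MvPolynomial (Fin 4) K ⧸ P) _).comp (Ideal.Quotient.mk P)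
  have hφ : ∀ x, φ x = 0 ↔ x ∈ P := by
    intro x
    rw [← Ideal.Quotient.eq_zero_iff_mem]
    simp only [φ, RingHom.comp_apply]
    exact FaithfulSMul.algebraMap_eq_zero_iff _ _
  have g1 := (hφ _).2 (hP (show fpoly1 K m q ∈ _ by simp))
  have g2 := (hφ _).2 (hP (show fpoly2 K m q ∈ _ by simp))
  have g3 := (hφ _).2 (hP (show fpoly3 K m q ∈ _ by simp))
  have g4 := (hφ _).2 (hP (show fpoly123 K m ∈ _ by simp))
  simp only [fpoly1, fpoly2, fpoly3, map_sub, map_mul, map_pow, sub_eq_zero] at g1 g2 g3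
  rw [SetLike.mem_coe, ← hφ, map_sub, sub_eq_zero, mono4, mono4]
  refine field_case hm hq _ _ _ _ g1 g2 g3 ?_ u hu
  intro h0
  unfold fpoly123 at g4
  split_ifs at g4
  · simp only [map_sub, map_mul, map_pow, h0, zero_mul, sub_zero] at g4
    exact eq_zero_of_pow_eq_zero g4
  · simp only [map_sub, map_mul, map_pow, h0, zero_mul, sub_zero,
      zero_pow (show m - 3 ≠ 0 by omega)] at g4
    exact eq_zero_of_pow_eq_zero g4

/-- in characteristic zero, `rad I_{L(m),1} = rad (f₁, f₂, f₃, f₁₂₃)`;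
in particular `I_{L(m),1}` is an almost set-theoretic complete intersection:
`ara I_{L(m),1} ≤ 4 = h(I_{L(m),1}) + 1`. -/
theorem statement17 {K : Type*} [Field K] [CharZero K] (m q : ℕ) (hm : 8 ≤ m)
    (hq : (Even m ∧ q = 0) ∨ (¬ Even m ∧ q = 1)) :
    (latIdeal1 K (Lm m q)).radical =
      (Ideal.span {fpoly1 K m q, fpoly2 K m q, fpoly3 K m q, fpoly123 K m}).radical ∧
    ara (latIdeal1 K (Lm m q)) ≤ 4 := by
  have hle := span_le_lat (K := K) m q hm hq
  have hrad : (latIdeal1 K (Lm m q)).radical =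
      (Ideal.span {fpoly1 K m q, fpoly2 K m q, fpoly3 K m q, fpoly123 K m}).radical :=
    le_antisymm ((Ideal.radical_le_radical_iff).2 (lat_le_radical m q hm hq))
      (Ideal.radical_mono (Ideal.span_le.2 hle))
  refine ⟨hrad, Nat.sInf_le ⟨![fpoly1 K m q, fpoly2 K m q, fpoly3 K m q, fpoly123 K m], ?_, ?_⟩⟩
  · intro i
    apply hle
    fin_cases i <;> simp
  · rw [hrad]
    congr 2
    ext x
    simp
    tauto

end LatticePaper
end

section
/- Let K be a field of positive characteristic and m ≥ 8 an integer, with q = 0 if m is even and q = 1 if m is odd. Let L(m) ⊂ ℤ⁴ be the sublattice generated by e₁ = (m+2q−3, −m+2q+5, −1, −1), e₂ = (−m−2q+5, m−2q−3, −1, −1), e₃ = (−m−2q+5, −1, m−3, −1). Then the lattice ideal I_{L(m),1} ⊂ K[x₁,…,x₄] is a set-theoretic complete intersection: ara(I_{L(m),1}) = h(I_{L(m),1}) = 3. -/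
open MvPolynomial

namespace LatticePaper


/-- The substitution killing the first `k` variables. -/
noncomputable def theta (K : Type*) [Field K] (k : ℕ) :
    MvPolynomial (Fin 4) K →ₐ[K] MvPolynomial (Fin 4) K :=
  aeval (fun i : Fin 4 => if (i : ℕ) < k then 0 else X i)

/-- The prime ideal generated by the first `k` variables. -/
noncomputable def PK (K : Type*) [Field K] (k : ℕ) : Ideal (MvPolynomial (Fin 4) K) :=
  RingHom.ker (theta K k)

instance PK_prime (K : Type*) [Field K] (k : ℕ) : (PK K k).IsPrime :=
  RingHom.ker_isPrime _

lemma X_mem_PK (K : Type*) [Field K] (k : ℕ) (i : Fin 4) : X i ∈ PK K k ↔ (i : ℕ) < k := by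
  rw [PK, RingHom.mem_ker]
  simp [theta]

lemma PK_lt (K : Type*) [Field K] (k : ℕ) (hk : k < 4) : PK K k < PK K (k + 1) := by
  refine lt_of_le_of_ne ?_ ?_
  · intro f hf
    have h : (theta K (k + 1)).comp (theta K k) = theta K (k + 1) := by
      apply MvPolynomial.algHom_ext
      intro i
      simp only [theta, AlgHom.comp_apply, aeval_X]
      split_ifs with h1 h2 h2 <;> simp
      · omega
      all_goals omega
    rw [PK, RingHom.mem_ker] at hf ⊢
    rw [← h, AlgHom.comp_apply, hf, map_zero]
  · intro h
    have := (X_mem_PK K (k + 1) ⟨k, hk⟩).2 (by simp)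
    rw [← h, X_mem_PK] at this
    simp at this

lemma height_PK (K : Type*) [Field K] (k : ℕ) (hk : k ≤ 4) : (k : ℕ∞) ≤ (PK K k).height := by
  induction k with
  | zero => simp
  | succ k ih =>
    have h1 := ih (by omega)
    have h2 := Ideal.height_add_one_le_of_lt_of_isPrime (PK_lt K k (by omega))
    refine le_trans ?_ h2
    push_cast
    gcongr

lemma PK4_le (K : Type*) [Field K] (P : Ideal (MvPolynomial (Fin 4) K))
    (h : ∀ i, X i ∈ P) : PK K 4 ≤ P := by
  intro f hf
  have e : (Ideal.Quotient.mkₐ K P).comp (theta K 4) = Ideal.Quotient.mkₐ K P := by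
    apply MvPolynomial.algHom_ext
    intro i
    have : (Ideal.Quotient.mk P) (X i) = 0 := Ideal.Quotient.eq_zero_iff_mem.2 (h i)
    simp [theta, this]
  rw [PK, RingHom.mem_ker] at hf
  have := DFunLike.congr_fun e f
  rw [AlgHom.comp_apply, hf, map_zero] at this
  exact Ideal.Quotient.eq_zero_iff_mem.1 this.symm

/-- Krull-type lower bound on the number of set-theoretic equations. -/
lemma lower (K : Type*) [Field K] (I : Ideal (MvPolynomial (Fin 4) K)) (hI : I ≤ PK K 4)
    (hX : ∀ P : Ideal (MvPolynomial (Fin 4) K), P.IsPrime → I ≤ P → X 0 ∈ P → ∀ i, X i ∈ P)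
    (s : ℕ) (f : Fin s → MvPolynomial (Fin 4) K) (hf : ∀ i, f i ∈ I)
    (hr : Ideal.radical (Ideal.span (Set.range f)) = Ideal.radical I) : 3 ≤ s := by
  have hmin : PK K 4 ∈ (Ideal.span (insert (X 0) (Set.range f))).minimalPrimes := by
    refine ⟨⟨inferInstance, ?_⟩, ?_⟩
    · rw [Ideal.span_le]
      rintro x (rfl | ⟨i, rfl⟩)
      · exact (X_mem_PK K 4 0).2 (by simp)
      · exact hI (hf i)
    · rintro Q ⟨hQ, hQ2⟩ -
      rw [Ideal.span_le, Set.insert_subset_iff] at hQ2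
      apply PK4_le
      apply hX Q hQ _ hQ2.1
      rw [← hQ.radical_le_iff, ← hr, hQ.radical_le_iff, Ideal.span_le]
      exact hQ2.2
  have h1 := Ideal.height_le_card_of_mem_minimalPrimes_span
    ((Set.finite_range f).insert _) hmin
  have h2 := (height_PK K 4 le_rfl).trans h1
  have h3 : 4 ≤ (insert (X 0) (Set.range f)).ncard := by exact_mod_cast h2
  have h4 := Set.ncard_insert_le (X 0 : MvPolynomial (Fin 4) K) (Set.range f)
  have h5 : (Set.range f).ncard ≤ s := by
    rw [← Set.image_univ]
    refine (Set.ncard_image_le Set.finite_univ).trans ?_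
    simp [Set.ncard_univ]
  omega

/-- The binomial of an integer vector. -/
noncomputable def bin (K : Type*) [Field K] (u : Fin 4 → ℤ) : MvPolynomial (Fin 4) K :=
  monomial (pp u) (1 : K) - monomial (np u) 1

lemma map_mono {K F : Type*} [Field K] [Field F] (g : MvPolynomial (Fin 4) K →+* F)
    (d : Fin 4 →₀ ℕ) : g (monomial d 1) = ∏ i, g (X i) ^ d i := by
  rw [MvPolynomial.monomial_eq, map_mul, Finsupp.prod_fintype _ _ (by simp)]
  simp [map_prod]

lemma bin_zero_iff {K F : Type*} [Field K] [Field F] (g : MvPolynomial (Fin 4) K →+* F)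
    (hg : ∀ i, g (X i) ≠ 0) (u : Fin 4 → ℤ) :
    g (bin K u) = 0 ↔ ∏ i, g (X i) ^ u i = 1 := by
  have e : ∏ i, g (X i) ^ u i = (∏ i, g (X i) ^ pp u i) / ∏ i, g (X i) ^ np u i := by
    rw [← Finset.prod_div_distrib]
    refine Finset.prod_congr rfl fun i _ => ?_
    rw [← zpow_natCast, ← zpow_natCast, ← zpow_sub₀ (hg i)]
    congr 1
    simp [pp, np]
  rw [e, div_eq_one_iff_eq (Finset.prod_ne_zero_iff.2 fun i _ => pow_ne_zero _ (hg i)), bin,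
    map_sub, map_mono, map_mono, sub_eq_zero]

lemma bin_at_zero {K F : Type*} [Field K] [Field F] (g : MvPolynomial (Fin 4) K →+* F)
    (hg : ∀ i, g (X i) = 0) (u : Fin 4 → ℤ) (w : Fin 4 → ℤ) (hw : ∀ i, 0 < w i)
    (hu : ∑ i, w i * u i = 0) : g (bin K u) = 0 := by
  by_cases h0 : u = 0
  · subst h0
    simp [bin, pp, np]
  have hpos : ∃ i, 0 < u i := by
    by_contra! h
    apply h0
    have := (Finset.sum_eq_zero_iff_of_nonpos
      (fun i _ => mul_nonpos_of_nonneg_of_nonpos (hw i).le (h i))).1 hu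
    funext i
    have := this i (Finset.mem_univ i)
    simpa [(hw i).ne'] using this
  have hneg : ∃ i, u i < 0 := by
    by_contra! h
    apply h0
    have := (Finset.sum_eq_zero_iff_of_nonneg
      (fun i _ => mul_nonneg (hw i).le (h i))).1 hu
    funext i
    have := this i (Finset.mem_univ i)
    simpa [(hw i).ne'] using this
  obtain ⟨i, hi⟩ := hpos
  obtain ⟨j, hj⟩ := hneg
  rw [bin, map_sub, map_mono, map_mono, Finset.prod_eq_zero (Finset.mem_univ i),
    Finset.prod_eq_zero (Finset.mem_univ j), sub_zero]
  · rw [hg]; apply zero_pow; simp [np]; omega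
  · rw [hg]; apply zero_pow; simp [pp]; omega

/-- The weight vector orthogonal to `L(m)`. -/
def wt (m q : ℕ) : Fin 4 → ℤ := ![(m : ℤ) - 4 - 2 * q, (m : ℤ) - 4 + 2 * q, (m : ℤ) - 4, (m : ℤ) - 4]

lemma wt_orth (m q : ℕ) (hq : q = 0 ∨ q = 1) (u : Fin 4 → ℤ) (hu : u ∈ Lm m q) :
    ∑ i, wt m q i * u i = 0 := by
  induction hu using AddSubgroup.closure_induction with
  | mem x hx =>
    rcases hx with rfl | rfl | rfl <;> rcases hq with rfl | rfl <;>
      simp [wt, e1v, e2v, e3v, Fin.sum_univ_four] <;> ring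
  | zero => simp
  | add x y _ _ hx hy => simp [mul_add, Finset.sum_add_distrib, hx, hy]
  | neg x _ hx => simp [hx]

lemma bin_mem (K : Type*) [Field K] {L : AddSubgroup (Fin 4 → ℤ)} {u : Fin 4 → ℤ} (hu : u ∈ L) :
    bin K u ∈ latIdeal1 K L := Ideal.subset_span ⟨u, hu, rfl⟩

/-- Existence of the exponents in the third equation. -/
lemma exists_abc (m q : ℕ) (hm : 8 ≤ m) (hq : q = 0 ∨ q = 1) (N : ℕ)
    (hN : 100 * m * m ≤ N) :
    ∃ a b c : ℕ, 0 < a ∧ ∃ i j : ℤ, ![-(a : ℤ), -b, -c, N] =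
        i • (e1v m q - e2v m q) + j • (e3v m q - e2v m q) - (N : ℤ) • e2v m q := by
  obtain ⟨M, rfl⟩ : ∃ M : ℕ, m = M + 4 := ⟨m - 4, by omega⟩
  have hM : (4 : ℤ) ≤ M := by omega
  have hq0 : (0 : ℤ) ≤ q := by positivity
  have hN' : 100 * ((M : ℤ) + 4) * (M + 4) ≤ N := by exact_mod_cast hN
  obtain ⟨D, hD⟩ : ∃ D : ℤ, D = 2 * (M + 2 * q) := ⟨_, rfl⟩
  obtain ⟨T, hT⟩ : ∃ T : ℤ, T = N * (M - 1 + 2 * q) := ⟨_, rfl⟩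
  have hD0 : 0 < D := by omega
  have r1 := Int.emod_nonneg T hD0.ne'
  have r2 := Int.emod_lt_of_pos T hD0
  have r3 := Int.mul_ediv_add_emod T D
  have hE0 : (0 : ℤ) < M + 2 := by omega
  have s1 := Int.emod_nonneg (N : ℤ) hE0.ne'
  have s2 := Int.emod_lt_of_pos (N : ℤ) hE0
  have s3 := Int.mul_ediv_add_emod (N : ℤ) (M + 2)
  obtain ⟨i, hi⟩ : ∃ i : ℤ, i = -(T / D + 1) := ⟨_, rfl⟩
  obtain ⟨j, hj⟩ : ∃ j : ℤ, j = -((N : ℤ) / (M + 2) + 1) := ⟨_, rfl⟩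
  obtain ⟨a, ha⟩ : ∃ a : ℤ, a = -(i * D + T) := ⟨_, rfl⟩
  obtain ⟨c, hc⟩ : ∃ c : ℤ, c = -(j * (M + 2) + N) := ⟨_, rfl⟩
  have ha1 : a = D - T % D := by rw [ha, hi]; linear_combination r3
  have hc1 : c = (M + 2) - N % (M + 2) := by rw [hc, hj]; linear_combination s3
  obtain ⟨b, hb⟩ : ∃ b : ℤ,
    b = 2 * i * (M - 2 * q) + j * (M + 2 - 2 * q) + N * (M + 1 - 2 * q) := ⟨_, rfl⟩
  have hw : (M - 2 * q) * a + (M + 2 * q) * b + M * c = M * N := by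
    rw [ha, hb, hc, hD, hT]
    rcases hq with rfl | rfl <;> push_cast <;> ring
  have hb0 : 0 ≤ b := by
    by_contra! h
    have h1 : (M - 2 * q) * a ≤ (M - 2 * q) * D :=
      mul_le_mul_of_nonneg_left (by omega) (by omega)
    have h2 : (M : ℤ) * c ≤ M * (M + 2) := mul_le_mul_of_nonneg_left (by omega) (by omega)
    have h3 : ((M : ℤ) + 2 * q) * b ≤ 0 :=
      mul_nonpos_of_nonneg_of_nonpos (by omega) (by omega)
    have h4 : (M : ℤ) * (100 * ((M : ℤ) + 4) * (M + 4)) ≤ M * N :=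
      mul_le_mul_of_nonneg_left hN' (by omega)
    rw [hD] at h1
    rcases hq with rfl | rfl <;> push_cast at h1 h3 hw <;> nlinarith [mul_self_nonneg (M : ℤ)]
  have ha0 : 0 < a := by omega
  have hc0 : 0 ≤ c := by omega
  lift a to ℕ using ha0.le
  lift b to ℕ using hb0
  lift c to ℕ using hc0
  refine ⟨a, b, c, by omega, i, j, ?_⟩
  funext k
  fin_cases k
  · simp [e1v, e2v, e3v]
    linear_combination -ha + i * hD + hT
  · simp [e1v, e2v, e3v]
    linear_combination -hb
  · simp [e1v, e2v, e3v]
    linear_combination -hc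
  · simp [e1v, e2v, e3v]

lemma u1_eq (m q : ℕ) (hm : 8 ≤ m) (hq : q = 0 ∨ q = 1) : ∃ A B : ℕ, 0 < A ∧ 0 < B ∧
    e1v m q - e2v m q = ![(A : ℤ), -B, 0, 0] := by
  refine ⟨2 * m + 4 * q - 8, 2 * m - 4 * q - 8, by omega, by omega, ?_⟩
  funext k
  fin_cases k <;> simp [e1v, e2v] <;> omega

lemma u2_eq (m q : ℕ) (hm : 8 ≤ m) (hq : q = 0 ∨ q = 1) : ∃ B C : ℕ, 0 < B ∧ 0 < C ∧
    e3v m q - e2v m q = ![0, -(B : ℤ), C, 0] := by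
  refine ⟨m - 2 * q - 2, m - 2, by omega, by omega, ?_⟩
  funext k
  fin_cases k <;> simp [e3v, e2v] <;> omega

lemma zero_case_s18 {K F : Type*} [Field K] [Field F] (g : MvPolynomial (Fin 4) K →+* F)
    {A B B' C a b c N : ℕ} (hA : 0 < A) (hB : 0 < B) (hB' : 0 < B') (hC : 0 < C) (ha : 0 < a)
    (hN : 0 < N) (h1 : g (bin K ![(A : ℤ), -B, 0, 0]) = 0)
    (h2 : g (bin K ![0, -(B' : ℤ), C, 0]) = 0)
    (h3 : g (bin K ![-(a : ℤ), -b, -c, N]) = 0) (i : Fin 4) (hi : g (X i) = 0) :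
    ∀ j, g (X j) = 0 := by
  simp only [bin, map_sub, map_mono, Fin.prod_univ_four, sub_eq_zero] at h1 h2 h3
  simp [pp, np] at h1 h2 h3
  have i01 : g (X 0) = 0 → g (X 1) = 0 := fun h => by
    rw [h, zero_pow hA.ne'] at h1; exact eq_zero_of_pow_eq_zero h1.symm
  have i10 : g (X 1) = 0 → g (X 0) = 0 := fun h => by
    rw [h, zero_pow hB.ne'] at h1; exact eq_zero_of_pow_eq_zero h1
  have i12 : g (X 1) = 0 → g (X 2) = 0 := fun h => by
    rw [h, zero_pow hB'.ne'] at h2; exact eq_zero_of_pow_eq_zero h2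
  have i21 : g (X 2) = 0 → g (X 1) = 0 := fun h => by
    rw [h, zero_pow hC.ne'] at h2; exact eq_zero_of_pow_eq_zero h2.symm
  have i03 : g (X 0) = 0 → g (X 3) = 0 := fun h => by
    rw [h, zero_pow ha.ne', zero_mul, zero_mul] at h3; exact eq_zero_of_pow_eq_zero h3
  have i30 : g (X 3) = 0 → g (X 0) = 0 := fun h => by
    rw [h, zero_pow hN.ne'] at h3
    rcases mul_eq_zero.1 h3.symm with h | h
    · rcases mul_eq_zero.1 h with h | h
      · exact eq_zero_of_pow_eq_zero h
      · exact i10 (eq_zero_of_pow_eq_zero h)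
    · exact i10 (i21 (eq_zero_of_pow_eq_zero h))
  have h0 : g (X 0) = 0 := by
    fin_cases i
    · exact hi
    · exact i10 hi
    · exact i10 (i21 hi)
    · exact i30 hi
  intro j
  fin_cases j
  · exact h0
  · exact i01 h0
  · exact i12 (i01 h0)
  · exact i03 h0

lemma ara_main {K : Type*} [Field K] {p : ℕ} [CharP K p] (hp : 0 < p)
    (m q : ℕ) (hm : 8 ≤ m) (hq : q = 0 ∨ q = 1) :
    ara (latIdeal1 K (Lm m q)) = 3 := by
  have hpp : p.Prime := (CharP.char_is_prime_or_zero K p).resolve_right hp.ne'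
  obtain ⟨k, hk⟩ : ∃ k : ℕ, k = 100 * m * m := ⟨_, rfl⟩
  obtain ⟨N, hN⟩ : ∃ N : ℕ, N = p ^ k := ⟨_, rfl⟩
  have hkN : 100 * m * m ≤ N := by
    rw [hN, ← hk]; exact (Nat.lt_pow_self hpp.one_lt).le
  have hN0 : 0 < N := hN ▸ pow_pos hp k
  obtain ⟨a, b, c, ha, i, j, h3⟩ := exists_abc m q hm hq N hkN
  obtain ⟨A, B, hA, hB, h1⟩ := u1_eq m q hm hq
  obtain ⟨B', C, hB', hC, h2⟩ := u2_eq m q hm hq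
  have m1 : e1v m q ∈ Lm m q := AddSubgroup.subset_closure (by simp)
  have m2 : e2v m q ∈ Lm m q := AddSubgroup.subset_closure (by simp)
  have m3 : e3v m q ∈ Lm m q := AddSubgroup.subset_closure (by simp)
  have l1 : ![(A : ℤ), -B, 0, 0] ∈ Lm m q := h1 ▸ sub_mem m1 m2
  have l2 : ![0, -(B' : ℤ), C, 0] ∈ Lm m q := h2 ▸ sub_mem m3 m2
  have l3 : ![-(a : ℤ), -b, -c, N] ∈ Lm m q := by
    rw [h3]
    exact sub_mem (add_mem (zsmul_mem (sub_mem m1 m2) _) (zsmul_mem (sub_mem m3 m2) _))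
      (zsmul_mem m2 _)
  have hw : ∀ i, 0 < wt m q i := by
    intro i
    fin_cases i <;> simp [wt] <;> omega
  have hle : latIdeal1 K (Lm m q) ≤ PK K 4 := by
    rw [latIdeal1, Ideal.span_le]
    rintro _ ⟨u, hu, rfl⟩
    change bin K u ∈ PK K 4
    rw [← Ideal.algebraMap_residueField_eq_zero]
    refine bin_at_zero _ (fun i => ?_) u (wt m q) hw (wt_orth m q hq u hu)
    rw [Ideal.algebraMap_residueField_eq_zero, X_mem_PK]
    exact i.2
  have hX : ∀ P : Ideal (MvPolynomial (Fin 4) K), P.IsPrime → latIdeal1 K (Lm m q) ≤ P →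
      X 0 ∈ P → ∀ i, X i ∈ P := by
    intro P hP hIP h0 i
    have key : ∀ u ∈ Lm m q, algebraMap _ P.ResidueField (bin K u) = 0 := fun u hu => by
      rw [Ideal.algebraMap_residueField_eq_zero]
      exact hIP (bin_mem K hu)
    rw [← Ideal.algebraMap_residueField_eq_zero] at h0 ⊢
    exact zero_case_s18 _ hA hB hB' hC ha hN0 (key _ l1) (key _ l2) (key _ l3) 0 h0 i
  have hmem : (3 : ℕ) ∈ {s : ℕ | ∃ f : Fin s → MvPolynomial (Fin 4) K,
      (∀ i, f i ∈ latIdeal1 K (Lm m q)) ∧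
      Ideal.radical (Ideal.span (Set.range f)) = Ideal.radical (latIdeal1 K (Lm m q))} := by
    refine ⟨![bin K ![(A : ℤ), -B, 0, 0], bin K ![0, -(B' : ℤ), C, 0],
      bin K ![-(a : ℤ), -b, -c, N]], ?_, ?_⟩
    · intro i
      fin_cases i
      · exact bin_mem K l1
      · exact bin_mem K l2
      · exact bin_mem K l3
    · apply le_antisymm
      · apply Ideal.radical_mono
        rw [Ideal.span_le]
        rintro _ ⟨i, rfl⟩
        fin_cases i
        · exact bin_mem K l1
        · exact bin_mem K l2
        · exact bin_mem K l3
      · rw [Ideal.radical_le_radical_iff, latIdeal1, Ideal.span_le]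
        rintro _ ⟨u, hu, rfl⟩
        change bin K u ∈ _
        rw [SetLike.mem_coe, Ideal.radical_eq_sInf, Ideal.mem_sInf]
        rintro P ⟨hP, hPp⟩
        rw [Ideal.span_le] at hP
        have g1 := hP ⟨0, rfl⟩
        have g2 := hP ⟨1, rfl⟩
        have g3 := hP ⟨2, rfl⟩
        simp only [Matrix.cons_val, SetLike.mem_coe] at g1 g2 g3
        obtain ⟨g, hg⟩ : ∃ g : MvPolynomial (Fin 4) K →+* P.ResidueField,
          g = algebraMap _ P.ResidueField := ⟨_, rfl⟩
        haveI : CharP P.ResidueField p :=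
          charP_of_injective_ringHom (g.comp (MvPolynomial.C : K →+* _)).injective p
        haveI : ExpChar P.ResidueField p := ExpChar.prime hpp
        rw [← Ideal.algebraMap_residueField_eq_zero, ← hg] at g1 g2 g3 ⊢
        by_cases hz : ∃ i, g (X i) = 0
        · obtain ⟨i, hi⟩ := hz
          exact bin_at_zero g (zero_case_s18 g hA hB hB' hC ha hN0 g1 g2 g3 i hi) u (wt m q) hw
            (wt_orth m q hq u hu)
        · push Not at hz
          rw [bin_zero_iff g hz] at g1 g2 g3 ⊢
          let φ : (Fin 4 → ℤ) → P.ResidueField := fun u => ∏ i, g (X i) ^ u i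
          have φadd : ∀ u v, φ (u + v) = φ u * φ v := fun u v => by
            simp only [φ, ← Finset.prod_mul_distrib, Pi.add_apply]
            exact Finset.prod_congr rfl fun i _ => zpow_add₀ (hz i) _ _
          have φsmul : ∀ (n : ℤ) u, φ (n • u) = φ u ^ n := fun n u => by
            simp only [φ, ← Finset.prod_zpow, Pi.smul_apply, smul_eq_mul]
            exact Finset.prod_congr rfl fun i _ => by rw [mul_comm, zpow_mul]
          have φ1 : φ (e1v m q - e2v m q) = 1 := by rw [h1]; exact g1
          have φ2 : φ (e3v m q - e2v m q) = 1 := by rw [h2]; exact g2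
          have φ3 : φ (i • (e1v m q - e2v m q) + j • (e3v m q - e2v m q)
              - (N : ℤ) • e2v m q) = 1 := by rw [← h3]; exact g3
          have φe2 : φ (e2v m q) = 1 := by
            rw [sub_eq_add_neg, ← neg_smul, φadd, φadd, φsmul, φsmul, φsmul, φ1, φ2, one_zpow,
              one_zpow, one_mul, one_mul, zpow_neg, inv_eq_one, zpow_natCast, hN] at φ3
            apply iterateFrobenius_inj P.ResidueField p k
            rw [iterateFrobenius_def, φ3, map_one]
          have φe1 : φ (e1v m q) = 1 := by
            rw [← sub_add_cancel (e1v m q) (e2v m q), φadd, φ1, φe2, one_mul]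
          have φe3 : φ (e3v m q) = 1 := by
            rw [← sub_add_cancel (e3v m q) (e2v m q), φadd, φ2, φe2, one_mul]
          change φ u = 1
          induction hu using AddSubgroup.closure_induction with
          | mem x hx => rcases hx with rfl | rfl | rfl <;> assumption
          | zero => simp [φ]
          | add x y _ _ hx hy => rw [φadd, hx, hy, one_mul]
          | neg x _ hx => rw [← neg_one_zsmul, φsmul, hx, one_zpow]
  apply le_antisymm
  · exact Nat.sInf_le hmem
  · refine le_csInf ⟨3, hmem⟩ ?_
    rintro s ⟨f, hf, hr⟩
    exact lower K _ hle hX s f hf hr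

/-- in positive characteristic the lattice ideal `I_{L(m),1}` is a
set-theoretic complete intersection: `ara I_{L(m),1} = 3 = h(I_{L(m),1})`. -/
theorem statement18 {K : Type*} [Field K] {p : ℕ} [CharP K p] (hp : 0 < p)
    (m q : ℕ) (hm : 8 ≤ m)
    (hq : (Even m ∧ q = 0) ∨ (¬ Even m ∧ q = 1)) :
    ara (latIdeal1 K (Lm m q)) = 3 := by
  exact ara_main hp m q hm (by
    rcases hq with h | h
    · exact Or.inl h.2
    · exact Or.inr h.2)

end LatticePaper
end
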